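/- Let M be a bounded complex of A-modules such that each term M_i is locally finite and each cohomology module H^i(M) is finite-dimensional over k. Let P be a bounded complex of A-modules with every term P_i finite-dimensional over k, with differentials δ^P_i, and let u : P → M be a chain map (A-linear maps u_i : P_i → M_i with δ_i ∘ u_i = u_{i+1} ∘ δ^P_i) which is null-homotopic: there exist A-linear maps h_i : P_i → M_{i−1} with u_i = δ_{i−1} ∘ h_i + h_{i+1} ∘ δ^P_i for all i. Then M admits a subcomplex F = (F_i) with every F_i finite-dimensional over k, with inclusion F ⊆ M a quasi-isomorphism, and with u_i(P_i) ⊆ F_i and h_i(P_i) ⊆ F_{i−1} for all i; in particular, the corestriction of u to a chain map P → F is null-homotopic. -/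

import Mathlib

/-- Given a complex `(M i, δ i)` of `A`-modules (the differential `δ i : M i → M (i+1)`)
and a family of submodules `F i ⊆ M i`, this is the natural map
`(F (i+1) ∩ ker δ_{i+1}) / δ_i(F i) → ker δ_{i+1} / range δ_i` induced by the inclusion;
the target is the cohomology of `M` at position `i + 1`. -/
noncomputable def inducedCohMap {A : Type*} [Ring A]
    {M : ℤ → Type*} [∀ i, AddCommGroup (M i)] [∀ i, Module A (M i)]
    (δ : ∀ i : ℤ, M i →ₗ[A] M (i + 1))
    (F : ∀ i : ℤ, Submodule A (M i)) (i : ℤ) :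
    (↥(F (i + 1) ⊓ LinearMap.ker (δ (i + 1))) ⧸
        Submodule.comap (F (i + 1) ⊓ LinearMap.ker (δ (i + 1))).subtype
          (Submodule.map (δ i) (F i))) →ₗ[A]
      (↥(LinearMap.ker (δ (i + 1))) ⧸
        Submodule.comap (LinearMap.ker (δ (i + 1))).subtype (LinearMap.range (δ i))) :=
  Submodule.liftQ _
    ((Submodule.mkQ _).comp (Submodule.inclusion inf_le_right))
    (by
      intro x hx
      obtain ⟨w, -, hwx⟩ := Submodule.mem_map.mp (Submodule.mem_comap.mp hx)
      rw [LinearMap.mem_ker, LinearMap.comp_apply, Submodule.mkQ_apply,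
        Submodule.Quotient.mk_eq_zero, Submodule.mem_comap]
      exact ⟨w, hwx⟩)

/-- A finitely generated submodule of the range of `f` is the image of a finitely generated
submodule. -/
theorem Submodule.FG.exists_fg_map_eq {R M N : Type*} [Ring R] [AddCommGroup M] [AddCommGroup N]
    [Module R M] [Module R N] (f : M →ₗ[R] N) {p : Submodule R N} (hp : p.FG)
    (hle : p ≤ LinearMap.range f) : ∃ q : Submodule R M, q.FG ∧ q.map f = p := by
  classical
  obtain ⟨s, rfl⟩ := hp
  have hs : (s : Set N) ⊆ f '' Set.univ := by
    intro x hx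
    obtain ⟨y, rfl⟩ := hle (Submodule.subset_span hx)
    exact ⟨y, trivial, rfl⟩
  obtain ⟨t, -, rfl⟩ := Finset.subset_set_image_iff.mp hs
  exact ⟨Submodule.span R t, ⟨t, rfl⟩, by rw [Submodule.map_span, Finset.coe_image]⟩

section Complex

variable {A : Type*} [Ring A] {M : ℤ → Type*} [∀ i, AddCommGroup (M i)] [∀ i, Module A (M i)]
  {δ : ∀ i : ℤ, M i →ₗ[A] M (i + 1)}

/-- If `F` is a subcomplex which represents every cohomology class and whose boundaries are exactly
the boundaries of `M` lying in `F`, then its inclusion is bijective on cohomology. -/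
theorem inducedCohMap_bijective {F : ∀ i : ℤ, Submodule A (M i)} {i : ℤ}
    (hsurj : ∀ z, δ (i + 1) z = 0 → ∃ y ∈ F (i + 1), δ (i + 1) y = 0 ∧ ∃ w, z = y + δ i w)
    (hinj : F (i + 1) ⊓ LinearMap.range (δ i) ≤ (F i).map (δ i)) :
    Function.Bijective (inducedCohMap δ F i) := by
  constructor
  · rw [← LinearMap.ker_eq_bot, eq_bot_iff]
    intro x hx
    obtain ⟨⟨x, hxF⟩, rfl⟩ := Submodule.Quotient.mk_surjective _ x
    have hx' := (Submodule.Quotient.mk_eq_zero _).mp (LinearMap.mem_ker.mp hx)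
    exact (Submodule.Quotient.mk_eq_zero _).mpr (hinj ⟨hxF.1, hx'⟩)
  · intro z
    obtain ⟨⟨z, hz⟩, rfl⟩ := Submodule.Quotient.mk_surjective _ z
    obtain ⟨y, hyF, hy, w, rfl⟩ := hsurj z hz
    refine ⟨Submodule.Quotient.mk ⟨y, hyF, hy⟩, ?_⟩
    refine (Submodule.Quotient.eq _).mpr ⟨-w, ?_⟩
    simp

/-- Cycles representing a finitely generated cohomology module can be taken in a finitely generated
submodule. -/
theorem exists_fg_le_ker_of_finite_cohomology (i : ℤ)
    [Module.Finite A (↥(LinearMap.ker (δ (i + 1))) ⧸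
      Submodule.comap (LinearMap.ker (δ (i + 1))).subtype (LinearMap.range (δ i)))] :
    ∃ S : Submodule A (M (i + 1)), S.FG ∧ S ≤ LinearMap.ker (δ (i + 1)) ∧
      ∀ z, δ (i + 1) z = 0 → ∃ y ∈ S, ∃ w, z = y + δ i w := by
  set D := Submodule.comap (LinearMap.ker (δ (i + 1))).subtype (LinearMap.range (δ i))
  obtain ⟨q, hq, hqtop⟩ := (Module.Finite.fg_top (R := A)
    (M := ↥(LinearMap.ker (δ (i + 1))) ⧸ D)).exists_fg_map_eq D.mkQ (by rw [D.range_mkQ])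
  refine ⟨q.map (LinearMap.ker (δ (i + 1))).subtype, hq.map _,
    Submodule.map_subtype_le _ _, fun z hz => ?_⟩
  have hmem : D.mkQ ⟨z, hz⟩ ∈ q.map D.mkQ := hqtop ▸ Submodule.mem_top
  obtain ⟨y, hyq, hy⟩ := hmem
  obtain ⟨w, hw⟩ := (Submodule.Quotient.eq D).mp hy.symm
  refine ⟨y, ⟨y, hyq, rfl⟩, w, ?_⟩
  rw [hw]
  simp

/-- In a bounded complex in which finitely generated submodules meet the boundaries in finitely
generated submodules, every termwise finitely generated subcomplex `B` is contained in one, `F`,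
whose boundaries are exactly the boundaries of `M` lying in `F`. -/
theorem exists_fg_subcomplex_inf_range_le {N : ℕ}
    (hbdd : ∀ i : ℤ, (N : ℤ) < |i| → ∀ x : M i, x = 0)
    (hinf : ∀ (i : ℤ) (p : Submodule A (M (i + 1))), p.FG → (p ⊓ LinearMap.range (δ i)).FG)
    {B : ∀ i : ℤ, Submodule A (M i)} (hBfg : ∀ i, (B i).FG)
    (hB : ∀ i, (B i).map (δ i) ≤ B (i + 1)) :
    ∃ F : ∀ i : ℤ, Submodule A (M i), (∀ i, (F i).FG) ∧ (∀ i, B i ≤ F i) ∧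
      (∀ i, (F i).map (δ i) ≤ F (i + 1)) ∧
      ∀ i, F (i + 1) ⊓ LinearMap.range (δ i) ≤ (F i).map (δ i) := by
  have descend : ∀ n : ℕ, ∃ F : ∀ i : ℤ, Submodule A (M i), (∀ i, (F i).FG) ∧ (∀ i, B i ≤ F i) ∧
      (∀ i, (F i).map (δ i) ≤ F (i + 1)) ∧
      ∀ i, (N : ℤ) < i + n → F (i + 1) ⊓ LinearMap.range (δ i) ≤ (F i).map (δ i) := by
    intro n
    induction n with
    | zero =>
      refine ⟨B, hBfg, fun _ => le_rfl, hB, fun i hi => ?_⟩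
      rintro _ ⟨-, w, rfl⟩
      rw [hbdd i (lt_of_lt_of_le (by simpa using hi) (le_abs_self i)) w, map_zero]
      exact zero_mem _
    | succ n ih =>
      obtain ⟨F, hfg, hBF, hF, hr⟩ := ih
      obtain ⟨j, hj⟩ : ∃ j : ℤ, j + n = N := ⟨N - n, by ring⟩
      obtain ⟨q, hqfg, hq⟩ := (hinf j _ (hfg (j + 1))).exists_fg_map_eq (δ j) inf_le_right
      have hne : ∀ i : ℤ, i ≠ j → Function.update F j (F j ⊔ q) i = F i :=
        fun i hi => Function.update_of_ne hi _ _
      have hle : ∀ i, F i ≤ Function.update F j (F j ⊔ q) i := by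
        intro i
        rcases eq_or_ne i j with rfl | hi
        · simp
        · rw [hne i hi]
      refine ⟨Function.update F j (F j ⊔ q), fun i => ?_, fun i => (hBF i).trans (hle i),
        fun i => ?_, fun i hi => ?_⟩
      · rcases eq_or_ne i j with rfl | hi
        · simpa using (hfg i).sup hqfg
        · rw [hne i hi]
          exact hfg i
      · rcases eq_or_ne i j with rfl | hi
        · rw [hne (i + 1) (by omega), Function.update_self, Submodule.map_sup, hq]
          exact sup_le (hF i) inf_le_left
        · rw [hne i hi]
          exact (hF i).trans (hle _)
      · rw [hne (i + 1) (by push_cast at hi; omega)]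
        rcases eq_or_ne i j with rfl | hij
        · rw [Function.update_self, Submodule.map_sup, hq]
          exact le_sup_right
        · rw [hne i hij]
          exact hr i (by push_cast at hi; omega)
  obtain ⟨F, hfg, hBF, hF, hr⟩ := descend (2 * N + 1)
  refine ⟨F, hfg, hBF, hF, fun i => ?_⟩
  rcases lt_or_ge (N : ℤ) (-i) with hi | hi
  · rintro _ ⟨-, w, rfl⟩
    rw [hbdd i (hi.trans_le (neg_le_abs i)) w, map_zero]
    exact zero_mem _
  · exact hr i (by push_cast; omega)

/-- A bounded complex with finitely generated cohomology, in which finitely generated submodules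
meet the boundaries in finitely generated submodules, has a termwise finitely generated
quasi-isomorphic subcomplex containing any given finitely generated submodules `E i`. -/
theorem exists_fg_quasiIso_subcomplex {N : ℕ}
    (hδδ : ∀ (i : ℤ) (x : M i), δ (i + 1) (δ i x) = 0)
    (hbdd : ∀ i : ℤ, (N : ℤ) < |i| → ∀ x : M i, x = 0)
    (hinf : ∀ (i : ℤ) (p : Submodule A (M (i + 1))), p.FG → (p ⊓ LinearMap.range (δ i)).FG)
    (hcoh : ∀ i : ℤ, Module.Finite A (↥(LinearMap.ker (δ (i + 1))) ⧸
      Submodule.comap (LinearMap.ker (δ (i + 1))).subtype (LinearMap.range (δ i))))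
    {E : ∀ i : ℤ, Submodule A (M i)} (hE : ∀ i, (E i).FG) :
    ∃ F : ∀ i : ℤ, Submodule A (M i), (∀ i, (F i).FG) ∧ (∀ i, E i ≤ F i) ∧
      (∀ i, (F i).map (δ i) ≤ F (i + 1)) ∧
      ∀ i, Function.Bijective (inducedCohMap δ F i) := by
  choose S hSfg hSker hS using fun i => exists_fg_le_ker_of_finite_cohomology (δ := δ) i
  obtain ⟨B, hBeq⟩ : ∃ B : ∀ i, Submodule A (M i),
      ∀ i, B (i + 1) = S i ⊔ E (i + 1) ⊔ (E i).map (δ i) :=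
    ⟨(Equiv.addRight (1 : ℤ)).piCongrLeft (fun j => Submodule A (M j))
      fun i => S i ⊔ E (i + 1) ⊔ (E i).map (δ i), fun i => Equiv.piCongrLeft_apply_apply _ _ _ i⟩
  have hsucc : ∀ j : ℤ, ∃ i, j = i + 1 := fun j => ⟨j - 1, by ring⟩
  have hBfg : ∀ j, (B j).FG := by
    intro j
    obtain ⟨i, rfl⟩ := hsucc j
    rw [hBeq]
    exact ((hSfg i).sup (hE _)).sup ((hE i).map _)
  have hEB : ∀ j, E j ≤ B j := by
    intro j
    obtain ⟨i, rfl⟩ := hsucc j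
    rw [hBeq]
    exact le_sup_right.trans le_sup_left
  have hB : ∀ j, (B j).map (δ j) ≤ B (j + 1) := by
    intro j
    obtain ⟨i, rfl⟩ := hsucc j
    rw [hBeq i, hBeq (i + 1), Submodule.map_sup, Submodule.map_sup]
    refine sup_le (sup_le ?_ le_sup_right) ?_
    · rintro _ ⟨x, hx, rfl⟩
      rw [LinearMap.mem_ker.mp (hSker i hx)]
      exact zero_mem _
    · rintro _ ⟨_, ⟨x, -, rfl⟩, rfl⟩
      rw [hδδ]
      exact zero_mem _
  obtain ⟨F, hfg, hBF, hF, hr⟩ := exists_fg_subcomplex_inf_range_le hbdd hinf hBfg hB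
  refine ⟨F, hfg, fun i => (hEB i).trans (hBF i), hF,
    fun i => inducedCohMap_bijective (fun z hz => ?_) (hr i)⟩
  obtain ⟨y, hy, w, hw⟩ := hS i z hz
  refine ⟨y, hBF _ ?_, hSker i hy, w, hw⟩
  rw [hBeq]
  exact Submodule.mem_sup_left (Submodule.mem_sup_left hy)

end Complex

/-- Let `M` be a bounded complex of `A`-modules (over a `k`-algebra `A`) whose terms are
locally finite `A`-modules and whose cohomology modules are finite-dimensional over `k`.
Let `P` be a bounded complex of `A`-modules with finite-dimensional (over `k`) terms, and
let `u : P → M` be a chain map which is null-homotopic via a homotopy `h` (here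
`h i : P (i+1) → M i` plays the role of `h_{i+1} : P_{i+1} → M_i`, and the homotopy
identity `u_j = δ_{j-1} ∘ h_j + h_{j+1} ∘ δ^P_j` is recorded at each position `j = i + 1`).
Then `M` admits a subcomplex `F` with finite-dimensional terms, whose inclusion into `M`
is a quasi-isomorphism, such that `u i (P i) ⊆ F i` and `h i (P (i+1)) ⊆ F i` for all `i`
(so the corestriction of `u` to a chain map `P → F` is null-homotopic). -/
theorem exists_finiteDimensional_quasiIso_subcomplex_nullHomotopy
    {k A : Type*} [Field k] [Ring A] [Algebra k A]
    (M : ℤ → Type*) [∀ i, AddCommGroup (M i)] [∀ i, Module k (M i)]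
    [∀ i, Module A (M i)] [∀ i, IsScalarTower k A (M i)]
    (δ : ∀ i : ℤ, M i →ₗ[A] M (i + 1))
    (hδδ : ∀ (i : ℤ) (x : M i), δ (i + 1) (δ i x) = 0)
    (hbdd : ∃ Nb : ℕ, ∀ i : ℤ, (Nb : ℤ) < |i| → ∀ x : M i, x = 0)
    (hlocfin : ∀ (i : ℤ) (p : Submodule A (M i)), p.FG → FiniteDimensional k ↥p)
    (hcohfin : ∀ i : ℤ, FiniteDimensional k
      (↥(LinearMap.ker (δ (i + 1))) ⧸
        Submodule.comap (LinearMap.ker (δ (i + 1))).subtype (LinearMap.range (δ i))))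
    (P : ℤ → Type*) [∀ i, AddCommGroup (P i)] [∀ i, Module k (P i)]
    [∀ i, Module A (P i)] [∀ i, IsScalarTower k A (P i)]
    (δP : ∀ i : ℤ, P i →ₗ[A] P (i + 1))
    (hδPδP : ∀ (i : ℤ) (x : P i), δP (i + 1) (δP i x) = 0)
    (hPbdd : ∃ Nb : ℕ, ∀ i : ℤ, (Nb : ℤ) < |i| → ∀ x : P i, x = 0)
    (hPfin : ∀ i : ℤ, FiniteDimensional k (P i))
    (u : ∀ i : ℤ, P i →ₗ[A] M i)
    (hu : ∀ i : ℤ, (δ i).comp (u i) = (u (i + 1)).comp (δP i))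
    (h : ∀ i : ℤ, P (i + 1) →ₗ[A] M i)
    (hhom : ∀ i : ℤ, u (i + 1) = (δ i).comp (h i) + (h (i + 1)).comp (δP (i + 1))) :
    ∃ F : ∀ i : ℤ, Submodule A (M i),
      (∀ i : ℤ, ∀ x ∈ F i, δ i x ∈ F (i + 1)) ∧
      (∀ i : ℤ, FiniteDimensional k ↥(F i)) ∧
      (∀ i : ℤ, Function.Bijective (inducedCohMap δ F i)) ∧
      (∀ (i : ℤ) (x : P i), u i x ∈ F i) ∧
      (∀ (i : ℤ) (x : P (i + 1)), h i x ∈ F i) := by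
  obtain ⟨N, hN⟩ := hbdd
  have hPA : ∀ i, Module.Finite A (P i) := fun i =>
    have := hPfin i
    Module.Finite.of_restrictScalars_finite k A (P i)
  have hcoh : ∀ i : ℤ, Module.Finite A (↥(LinearMap.ker (δ (i + 1))) ⧸
      Submodule.comap (LinearMap.ker (δ (i + 1))).subtype (LinearMap.range (δ i))) := fun i =>
    have := hcohfin i
    Module.Finite.of_restrictScalars_finite k A _
  have hinf : ∀ (i : ℤ) (p : Submodule A (M (i + 1))), p.FG →
      (p ⊓ LinearMap.range (δ i)).FG := by
    intro i p hp
    have := hlocfin _ p hp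
    have : FiniteDimensional k ↥(p ⊓ LinearMap.range (δ i)) :=
      FiniteDimensional.of_injective
        ((Submodule.inclusion (inf_le_left : p ⊓ LinearMap.range (δ i) ≤ p)).restrictScalars k)
        (Submodule.inclusion_injective inf_le_left)
    exact Module.Finite.iff_fg.mp (Module.Finite.of_restrictScalars_finite k A _)
  obtain ⟨F, hfg, hEF, hF, hbij⟩ := exists_fg_quasiIso_subcomplex hδδ hN hinf hcoh
    (E := fun i => LinearMap.range (u i) ⊔ LinearMap.range (h i))
    fun i => (Module.Finite.iff_fg.mp inferInstance).sup (Module.Finite.iff_fg.mp inferInstance)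
  exact ⟨F, fun i x hx => hF i ⟨x, hx, rfl⟩, fun i => hlocfin i _ (hfg i), hbij,
    fun i x => hEF i (Submodule.mem_sup_left ⟨x, rfl⟩),
    fun i x => hEF i (Submodule.mem_sup_right ⟨x, rfl⟩)⟩
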